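/- Suppose G is a marked graph with three unmarked vertices u, v, w such that u, v, w are pairwise adjacent, u is unlooped, v and w are looped, and every vertex x ∉ {u,v,w} is adjacent to either 0 or precisely 2 of u, v, w. Let G' be the marked graph obtained from G by removing the three edges {u,v}, {u,w} and {v,w} (all else unchanged). Then ⟨G⟩ = ⟨G'⟩. -/

import Mathlib

open MvPolynomial

/-- A marked graph: a finite vertex set, an adjacency matrix over GF(2)
(the diagonal entry at `v` is 1 iff `v` carries a loop; for `v ≠ w` the `(v,w)` entry
is 1 iff `v` and `w` are adjacent), a designated set of marked vertices, and a number
of free loops. -/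
structure MarkedGraph (V : Type) [Fintype V] [DecidableEq V] where
  adj : Matrix V V (ZMod 2)
  marked : V → Bool
  freeLoops : ℕ

namespace MarkedGraph

variable {V : Type} [Fintype V] [DecidableEq V]

/-- GF(2)-nullity of a square matrix: the dimension of its kernel. -/
noncomputable def nullity {ι : Type*} [Fintype ι] (M : Matrix ι ι (ZMod 2)) : ℕ :=
  Module.finrank (ZMod 2) (LinearMap.ker M.mulVecLin)

/-- The diagonal matrix `Δ_T` over GF(2) whose diagonal entry at `v` is 1 iff `v ∈ T`. -/
def delta (T : Finset V) : Matrix V V (ZMod 2) :=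
  Matrix.diagonal fun v => if v ∈ T then 1 else 0

/-- The vertices kept in the submatrix `𝒜(G)_T`: delete each marked vertex whose
diagonal entry in `𝒜(G) + Δ_T` is 0. -/
def keep (G : MarkedGraph V) (T : Finset V) : Finset V :=
  Finset.univ.filter fun v => ¬ (G.marked v = true ∧ (G.adj + delta T) v v = 0)

/-- The submatrix `𝒜(G)_T` of `𝒜(G) + Δ_T`. -/
def subMat (G : MarkedGraph V) (T : Finset V) :
    Matrix (G.keep T) (G.keep T) (ZMod 2) :=
  fun i j => (G.adj + delta T) i.1 j.1

/-- The marked-graph bracket polynomial `[G] ∈ ℤ[A,B,d]`, where `A = X 0`, `B = X 1`,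
`d = X 2`:  `[G] = d^φ ⬝ Σ_{T ⊆ V(G)} A^(n-|T|) B^(|T|) d^(ν(𝒜(G)_T))`. -/
noncomputable def bracket (G : MarkedGraph V) : MvPolynomial (Fin 3) ℤ :=
  X 2 ^ G.freeLoops *
    ∑ T : Finset V,
      X 0 ^ (Fintype.card V - T.card) * X 1 ^ T.card * X 2 ^ nullity (G.subMat T)

/-- `x` is a neighbor of `v` (no vertex is a neighbor of itself). -/
def nbr (G : MarkedGraph V) (v x : V) : Prop := x ≠ v ∧ G.adj v x = 1

instance (G : MarkedGraph V) (v x : V) : Decidable (G.nbr v x) :=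
  inferInstanceAs (Decidable (x ≠ v ∧ G.adj v x = 1))

/-- Delete the vertices in `s`, together with all incident edges
(marks and free loops unchanged). -/
def delete (G : MarkedGraph V) (s : Finset V) : MarkedGraph {v : V // v ∉ s} where
  adj := fun i j => G.adj i.1 j.1
  marked := fun i => G.marked i.1
  freeLoops := G.freeLoops

/-- The local complement `G^v`: toggle every entry of the adjacency matrix (diagonal
entries included) whose row and column indices are both neighbors of `v`. -/
def localComp (G : MarkedGraph V) (v : V) : MarkedGraph V :=
  { G with adj := fun x y => if G.nbr v x ∧ G.nbr v y then G.adj x y + 1 else G.adj x y }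

/-- `G - {v,v}`: remove the loop at `v` (set the diagonal entry at `v` to 0). -/
def removeLoop (G : MarkedGraph V) (v : V) : MarkedGraph V :=
  { G with adj := fun x y => if x = v ∧ y = v then 0 else G.adj x y }

/-- `G + I`: toggle all loops. -/
def addI (G : MarkedGraph V) : MarkedGraph V :=
  { G with adj := G.adj + 1 }

/-- `G⁺`: adjoin one free loop. -/
def addFreeLoop (G : MarkedGraph V) : MarkedGraph V :=
  { G with freeLoops := G.freeLoops + 1 }

/-- The condition under which the pivot `G^{vw}` toggles the adjacency between `x`
and `y`: `x` is a neighbor of `v`, `y` is a neighbor of `w`, and either `x` is not a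
neighbor of `w` or `y` is not a neighbor of `v`. -/
def pivotCond (G : MarkedGraph V) (v w x y : V) : Prop :=
  G.nbr v x ∧ G.nbr w y ∧ (¬ G.nbr w x ∨ ¬ G.nbr v y)

instance (G : MarkedGraph V) (v w x y : V) : Decidable (G.pivotCond v w x y) :=
  inferInstanceAs (Decidable (G.nbr v x ∧ G.nbr w y ∧ (¬ G.nbr w x ∨ ¬ G.nbr v y)))

/-- The pivot `G^{vw}`: toggle the adjacency between every pair of distinct vertices
`x, y ∉ {v,w}` such that `x` is a neighbor of `v`, `y` is a neighbor of `w`, and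
either `x` is not a neighbor of `w` or `y` is not a neighbor of `v`
(loops are unaffected). -/
def pivot (G : MarkedGraph V) (v w : V) : MarkedGraph V :=
  { G with adj := fun x y =>
      if x ≠ v ∧ x ≠ w ∧ y ≠ v ∧ y ≠ w ∧ x ≠ y ∧
          (G.pivotCond v w x y ∨ G.pivotCond v w y x)
      then G.adj x y + 1 else G.adj x y }

/-- Interchange the neighbors of `v` and `w` in an adjacency matrix, keeping loops
and the edge between `v` and `w` unchanged. -/
def swapAdjacencies (M : Matrix V V (ZMod 2)) (v w : V) : Matrix V V (ZMod 2) :=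
  fun x y =>
    if x = y then M x y
    else if (x = v ∧ y = w) ∨ (x = w ∧ y = v) then M x y
    else M (Equiv.swap v w x) (Equiv.swap v w y)

/-- The marked pivot `G_c^{vw}`: the pivot `G^{vw}` with the marks on `v` and `w`
toggled and the neighbors of `v` and `w` interchanged (loops, the edge between `v`
and `w`, and free loops unchanged). -/
def markedPivot (G : MarkedGraph V) (v w : V) : MarkedGraph V where
  adj := swapAdjacencies (G.pivot v w).adj v w
  marked := fun u => if u = v ∨ u = w then !(G.marked u) else G.marked u
  freeLoops := G.freeLoops

/-- The disjoint union of two marked graphs: block-diagonal adjacency matrix,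
each vertex marked as it was, free loops added. -/
def disjUnion {V₁ V₂ : Type} [Fintype V₁] [DecidableEq V₁] [Fintype V₂] [DecidableEq V₂]
    (G₁ : MarkedGraph V₁) (G₂ : MarkedGraph V₂) : MarkedGraph (V₁ ⊕ V₂) where
  adj := Matrix.fromBlocks G₁.adj 0 0 G₂.adj
  marked := Sum.elim G₁.marked G₂.marked
  freeLoops := G₁.freeLoops + G₂.freeLoops

/-- Remove the three edges `{u,v}`, `{u,w}`, `{v,w}` (all else unchanged). -/
def removeEdges3 (G : MarkedGraph V) (u v w : V) : MarkedGraph V :=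
  { G with adj := fun x y =>
      if (x = u ∧ y = v) ∨ (x = v ∧ y = u) ∨ (x = u ∧ y = w) ∨ (x = w ∧ y = u) ∨
          (x = v ∧ y = w) ∨ (x = w ∧ y = v)
      then 0 else G.adj x y }

/-- Adjoin one isolated, unmarked vertex with no incident edges; it is looped iff
`loop = true`. -/
def addIsolated (G : MarkedGraph V) (loop : Bool) : MarkedGraph (Option V) where
  adj := fun x y =>
    match x, y with
    | some a, some b => G.adj a b
    | none, none => if loop then 1 else 0
    | _, _ => 0
  marked := fun x => match x with | some a => G.marked a | none => false
  freeLoops := G.freeLoops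

/-- The number of vertices of `s` that are adjacent to `x`. -/
def countAdj (G : MarkedGraph V) (x : V) (s : Finset V) : ℕ :=
  (s.filter fun y => G.adj x y = 1).card

/-- The reduced marked-graph bracket `⟨G⟩ ∈ ℤ[A, A⁻¹]`: substitute `B ↦ A⁻¹` and
`d ↦ -A² - A⁻²` in `[G]`. -/
noncomputable def reducedBracket (G : MarkedGraph V) : LaurentPolynomial ℤ :=
  MvPolynomial.aeval
    ![LaurentPolynomial.T 1, LaurentPolynomial.T (-1),
      -LaurentPolynomial.T 2 - LaurentPolynomial.T (-2)] G.bracket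

/-- The number of looped vertices of `G`. -/
def numLoops (G : MarkedGraph V) : ℕ :=
  (Finset.univ.filter fun v => G.adj v v = 1).card

/-- The Jones polynomial `V_G = (-1)^n ⬝ q^(3n-6ℓ) ⬝ ⟨G⟩(q⁻¹)`, as a Laurent
polynomial in the formal variable `q` (representing `t^(1/4)`); substituting
`A ↦ q⁻¹` in `⟨G⟩` amounts to substituting `A ↦ q⁻¹`, `B ↦ q`, `d ↦ -q² - q⁻²`
in `[G]`. -/
noncomputable def jones (G : MarkedGraph V) : LaurentPolynomial ℤ :=
  (-1) ^ Fintype.card V *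
    LaurentPolynomial.T (3 * (Fintype.card V : ℤ) - 6 * (G.numLoops : ℤ)) *
    MvPolynomial.aeval
      ![LaurentPolynomial.T (-1), LaurentPolynomial.T 1,
        -LaurentPolynomial.T 2 - LaurentPolynomial.T (-2)] G.bracket

end MarkedGraph

namespace MarkedGraph

variable {V : Type} [Fintype V] [DecidableEq V]

/-- The kernel of `subMat`, seen inside `V → ZMod 2` (zero on deleted vertices). -/
def bigKer (G : MarkedGraph V) (T : Finset V) : Submodule (ZMod 2) (V → ZMod 2) where
  carrier := {g | ∀ x, (x ∉ G.keep T → g x = 0) ∧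
    (x ∈ G.keep T → ∑ y, (G.adj + delta T) x y * g y = 0)}
  zero_mem' := by intro x; simp
  add_mem' := by
    intro a b ha hb x
    refine ⟨fun h => ?_, fun h => ?_⟩
    · simp [(ha x).1 h, (hb x).1 h]
    · simp only [Pi.add_apply, mul_add, Finset.sum_add_distrib]
      rw [(ha x).2 h, (hb x).2 h, add_zero]
  smul_mem' := by
    intro c a ha x
    refine ⟨fun h => ?_, fun h => ?_⟩
    · simp [(ha x).1 h]
    · simp only [Pi.smul_apply, smul_eq_mul, mul_left_comm _ c, ← Finset.mul_sum]
      rw [(ha x).2 h, mul_zero]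

lemma mem_bigKer (G : MarkedGraph V) (T : Finset V) (g : V → ZMod 2) :
    g ∈ G.bigKer T ↔ ∀ x, (x ∉ G.keep T → g x = 0) ∧
    (x ∈ G.keep T → ∑ y, (G.adj + delta T) x y * g y = 0) := Iff.rfl

lemma sum_keep (G : MarkedGraph V) (T : Finset V) (g : V → ZMod 2)
    (hg : ∀ x, x ∉ G.keep T → g x = 0) (x : V) :
    ∑ y, (G.adj + delta T) x y * g y
      = ∑ y : G.keep T, (G.adj + delta T) x y.1 * g y.1 := by
  rw [← Finset.sum_subset (Finset.subset_univ (G.keep T))]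
  · rw [← Finset.sum_coe_sort]
  · intro y _ hy
    rw [hg y hy, mul_zero]

lemma nullity_eq (G : MarkedGraph V) (T : Finset V) :
    nullity (G.subMat T) = Module.finrank (ZMod 2) (G.bigKer T) := by
  unfold nullity
  symm
  let r : (V → ZMod 2) →ₗ[ZMod 2] (G.keep T → ZMod 2) :=
    LinearMap.funLeft (ZMod 2) (ZMod 2) (fun y : G.keep T => y.1)
  have hr : ∀ g y, r g y = g y.1 := fun g y => rfl
  refine LinearEquiv.finrank_eq (LinearEquiv.ofBijective
    (r.restrict (p := G.bigKer T) (q := LinearMap.ker (G.subMat T).mulVecLin) ?_) ⟨?_, ?_⟩)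
  · intro g hg
    rw [mem_bigKer] at hg
    rw [LinearMap.mem_ker]
    ext x
    have := (hg x.1).2 x.2
    rw [sum_keep G T g (fun x => (hg x).1)] at this
    simpa [Matrix.mulVec, dotProduct, subMat, hr] using this
  · rw [← LinearMap.ker_eq_bot, LinearMap.ker_eq_bot']
    rintro ⟨g, hg⟩ h
    have h' : r g = 0 := congrArg Subtype.val h
    rw [mem_bigKer] at hg
    ext x
    by_cases hx : x ∈ G.keep T
    · exact congrFun h' ⟨x, hx⟩
    · exact (hg x).1 hx
  · rintro ⟨h, hh⟩
    rw [LinearMap.mem_ker] at hh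
    have hz : ∀ x, x ∉ G.keep T → (fun x => if hx : x ∈ G.keep T then h ⟨x, hx⟩ else 0) x = 0 := by
      intro x hx; simp [hx]
    refine ⟨⟨fun x => if hx : x ∈ G.keep T then h ⟨x, hx⟩ else 0, ?_⟩, ?_⟩
    · rw [mem_bigKer]
      refine fun x => ⟨hz x, fun hx => ?_⟩
      rw [sum_keep G T _ hz]
      have := congrFun hh ⟨x, hx⟩
      simpa [Matrix.mulVec, dotProduct, subMat] using this
    · apply Subtype.ext
      ext y
      show (if hx : y.1 ∈ G.keep T then h ⟨y.1, hx⟩ else 0) = h y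
      simp

/-- The vertices other than `u, v, w`. -/
def others (u v w : V) : Finset V := Finset.univ.filter fun y => y ≠ u ∧ y ≠ v ∧ y ≠ w

lemma mem_others {u v w y : V} : y ∈ others u v w ↔ y ≠ u ∧ y ≠ v ∧ y ≠ w := by
  simp [others]

lemma univ_eq (u v w : V) :
    (Finset.univ : Finset V) = insert u (insert v (insert w (others u v w))) := by
  ext y; simp only [Finset.mem_univ, Finset.mem_insert, mem_others]; tauto

lemma sum_univ_split {M : Type*} [AddCommMonoid M] {u v w : V}
    (huv : u ≠ v) (huw : u ≠ w) (hvw : v ≠ w) (F : V → M) :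
    ∑ y, F y = F u + (F v + (F w + ∑ y ∈ others u v w, F y)) := by
  rw [univ_eq u v w, Finset.sum_insert, Finset.sum_insert, Finset.sum_insert] <;>
    simp [mem_others, *]

/-- The part of the kernel condition at vertices other than `u, v, w`. -/
def Rest (G : MarkedGraph V) (u v w : V) (T : Finset V) (g : V → ZMod 2) : Prop :=
  ∀ x ∈ others u v w, (x ∉ G.keep T → g x = 0) ∧
    (x ∈ G.keep T → ∑ y ∈ others u v w, (G.adj + delta T) x y * g y
      + (G.adj x u * g u + G.adj x v * g v + G.adj x w * g w) = 0)

/-- Contribution of the other vertices to the row of `z`. -/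
def outer (G : MarkedGraph V) (u v w z : V) (g : V → ZMod 2) : ZMod 2 :=
  ∑ y ∈ others u v w, G.adj z y * g y

lemma delta_ne (T : Finset V) {x y : V} (h : x ≠ y) : delta T x y = 0 := by
  simp [delta, h]

lemma delta_self (T : Finset V) (x : V) : delta T x x = if x ∈ T then 1 else 0 := by
  simp [delta]

lemma mem_keep (G : MarkedGraph V) (T : Finset V) (x : V) :
    x ∈ G.keep T ↔ ¬ (G.marked x = true ∧ (G.adj + delta T) x x = 0) := by
  simp [keep]

lemma mem_bigKer_iff (G H : MarkedGraph V) {u v w : V}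
    (huv : u ≠ v) (huw : u ≠ w) (hvw : v ≠ w)
    (hmu : G.marked u = false) (hmv : G.marked v = false) (hmw : G.marked w = false)
    (hmark : H.marked = G.marked)
    (hadj : ∀ x y, (x ∈ others u v w ∨ y ∈ others u v w) → H.adj x y = G.adj x y)
    (T T' : Finset V) (hT : ∀ y ∈ others u v w, (y ∈ T' ↔ y ∈ T)) (g : V → ZMod 2) :
    g ∈ H.bigKer T' ↔ G.Rest u v w T g ∧
      ((H.adj u u + if u ∈ T' then 1 else 0) * g u + H.adj u v * g v + H.adj u w * g w
        + G.outer u v w u g = 0 ∧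
      H.adj v u * g u + (H.adj v v + if v ∈ T' then 1 else 0) * g v + H.adj v w * g w
        + G.outer u v w v g = 0 ∧
      H.adj w u * g u + H.adj w v * g v + (H.adj w w + if w ∈ T' then 1 else 0) * g w
        + G.outer u v w w g = 0) := by
  have hd : ∀ x y, x ∈ others u v w → delta T' x y = delta T x y := by
    intro x y hx
    by_cases h : x = y
    · subst h; simp [delta_self, hT x hx]
    · simp [delta_ne _ h]
  have hk : ∀ x ∈ others u v w, (x ∈ H.keep T' ↔ x ∈ G.keep T) := by
    intro x hx
    rw [mem_keep, mem_keep, hmark, Matrix.add_apply, Matrix.add_apply, hd x x hx,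
      hadj x x (Or.inl hx)]
  have hku : u ∈ H.keep T' := by rw [mem_keep, hmark, hmu]; simp
  have hkv : v ∈ H.keep T' := by rw [mem_keep, hmark, hmv]; simp
  have hkw : w ∈ H.keep T' := by rw [mem_keep, hmark, hmw]; simp
  have hsumo : ∀ x ∈ others u v w, ∑ y, (H.adj + delta T') x y * g y =
      ∑ y ∈ others u v w, (G.adj + delta T) x y * g y
      + (G.adj x u * g u + G.adj x v * g v + G.adj x w * g w) := by
    intro x hx
    rw [sum_univ_split huv huw hvw]
    have hx' := mem_others.1 hx
    simp only [Matrix.add_apply, hd x _ hx, hadj x _ (Or.inl hx), delta_ne T hx'.1,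
      delta_ne T hx'.2.1, delta_ne T hx'.2.2, add_zero]
    ring
  have hsumi : ∀ z, (z = u ∨ z = v ∨ z = w) → ∑ y ∈ others u v w, (H.adj + delta T') z y * g y =
      G.outer u v w z g := by
    intro z hz
    refine Finset.sum_congr rfl fun y hy => ?_
    have hy' := mem_others.1 hy
    have : z ≠ y := by rintro rfl; tauto
    rw [Matrix.add_apply, delta_ne _ this, add_zero, hadj z y (Or.inr hy)]
  have key : ∀ z, (z = u ∨ z = v ∨ z = w) → ∑ y, (H.adj + delta T') z y * g y =
      (H.adj z u + delta T' z u) * g u + (H.adj z v + delta T' z v) * g v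
      + (H.adj z w + delta T' z w) * g w + G.outer u v w z g := by
    intro z hz
    rw [sum_univ_split huv huw hvw, hsumi z hz]
    simp only [Matrix.add_apply]
    ring
  have ku := key u (by simp)
  have kv := key v (by simp)
  have kw := key w (by simp)
  simp only [delta_self, delta_ne T' huv, delta_ne T' huw, delta_ne T' hvw,
    delta_ne T' huv.symm, delta_ne T' huw.symm, delta_ne T' hvw.symm, add_zero] at ku kv kw
  rw [← ku, ← kv, ← kw, mem_bigKer]
  constructor
  · intro h
    refine ⟨fun x hx => ?_, (h u).2 hku, (h v).2 hkv, (h w).2 hkw⟩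
    rw [← hk x hx, ← hsumo x hx]
    exact h x
  · rintro ⟨h, h1, h2, h3⟩ x
    by_cases hxu : x = u
    · subst hxu; exact ⟨fun h => absurd hku h, fun _ => h1⟩
    by_cases hxv : x = v
    · subst hxv; exact ⟨fun h => absurd hkv h, fun _ => h2⟩
    by_cases hxw : x = w
    · subst hxw; exact ⟨fun h => absurd hkw h, fun _ => h3⟩
    have hx : x ∈ others u v w := mem_others.2 ⟨hxu, hxv, hxw⟩
    rw [hk x hx, hsumo x hx]
    exact h x hx

/-- The indicator function of `{u, v, w}`. -/
def ind3 (u v w : V) : V → ZMod 2 := fun y => if y ∈ others u v w then 0 else 1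

lemma ind3_u (u v w : V) : ind3 u v w u = 1 := by simp [ind3, mem_others]
lemma ind3_v (u v w : V) : ind3 u v w v = 1 := by simp [ind3, mem_others]
lemma ind3_w (u v w : V) : ind3 u v w w = 1 := by simp [ind3, mem_others]
lemma ind3_o {u v w y : V} (h : y ∈ others u v w) : ind3 u v w y = 0 := by simp [ind3, h]

lemma outer_add (G : MarkedGraph V) (u v w z : V) (g : V → ZMod 2) (t : ZMod 2) :
    G.outer u v w z (g + t • ind3 u v w) = G.outer u v w z g := by
  refine Finset.sum_congr rfl fun y hy => ?_
  simp [ind3_o hy]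

lemma rest_add (G : MarkedGraph V) (u v w : V)
    (hev : ∀ x ∈ others u v w, G.adj x u + G.adj x v + G.adj x w = 0)
    (T : Finset V) (g : V → ZMod 2) (t : ZMod 2) :
    G.Rest u v w T (g + t • ind3 u v w) ↔ G.Rest u v w T g := by
  unfold Rest
  refine forall₂_congr fun x hx => ?_
  have h1 : ∑ y ∈ others u v w, (G.adj + delta T) x y * (g + t • ind3 u v w) y
      = ∑ y ∈ others u v w, (G.adj + delta T) x y * g y := by
    refine Finset.sum_congr rfl fun y hy => ?_
    simp [ind3_o hy]
  have h2 : G.adj x u * (g + t • ind3 u v w) u + G.adj x v * (g + t • ind3 u v w) v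
      + G.adj x w * (g + t • ind3 u v w) w
      = G.adj x u * g u + G.adj x v * g v + G.adj x w * g w := by
    simp only [Pi.add_apply, Pi.smul_apply, ind3_u, ind3_v, ind3_w, smul_eq_mul]
    linear_combination t * hev x hx
  rw [h1, h2]
  simp [ind3_o hx]

lemma rest_ind (G : MarkedGraph V) (u v w : V)
    (hev : ∀ x ∈ others u v w, G.adj x u + G.adj x v + G.adj x w = 0)
    (T : Finset V) : G.Rest u v w T (ind3 u v w) := by
  have := (rest_add G u v w hev T 0 1).2 (by intro x _; simp)
  simpa using this

/-- Adding a linear multiple of the indicator function of `{u,v,w}`. -/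
def shift (u v w : V) (i j k : ZMod 2) : (V → ZMod 2) →ₗ[ZMod 2] (V → ZMod 2) where
  toFun g := g + (i * g u + j * g v + k * g w) • ind3 u v w
  map_add' a b := by ext y; simp; ring
  map_smul' c a := by ext y; simp; ring

lemma finrank_le_of_shift (G : MarkedGraph V) (u v w : V)
    (hev : ∀ x ∈ others u v w, G.adj x u + G.adj x v + G.adj x w = 0)
    (T : Finset V) (K K' : Submodule (ZMod 2) (V → ZMod 2))
    (E E' : ZMod 2 → ZMod 2 → ZMod 2 → ZMod 2 → ZMod 2 → Prop)
    (hK : ∀ g, g ∈ K ↔ G.Rest u v w T g ∧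
      E (g u) (g v) (g w) (G.outer u v w u g) (G.outer u v w v g))
    (hK' : ∀ g, g ∈ K' ↔ G.Rest u v w T g ∧
      E' (g u) (g v) (g w) (G.outer u v w u g) (G.outer u v w v g))
    (i j k : ZMod 2)
    (h1 : ∀ a b c p q, E a b c p q → E' (a + (i * a + j * b + k * c))
      (b + (i * a + j * b + k * c)) (c + (i * a + j * b + k * c)) p q)
    (h2 : ∀ t, E t t t 0 0 → i * t + j * t + k * t = t → t = 0) :
    Module.finrank (ZMod 2) K ≤ Module.finrank (ZMod 2) K' := by
  have hmap : ∀ g ∈ K, shift u v w i j k g ∈ K' := by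
    intro g hg
    rw [hK] at hg
    rw [hK']
    show G.Rest u v w T (g + (i * g u + j * g v + k * g w) • ind3 u v w) ∧ _
    refine ⟨(rest_add G u v w hev T g _).2 hg.1, ?_⟩
    have := h1 _ _ _ _ _ hg.2
    simpa [shift, outer_add, ind3_u, ind3_v, ind3_w] using this
  refine LinearMap.finrank_le_finrank_of_injective
    (f := (shift u v w i j k).restrict (p := K) (q := K') hmap) ?_
  rw [← LinearMap.ker_eq_bot, LinearMap.ker_eq_bot']
  rintro ⟨g, hg⟩ h
  have h' : shift u v w i j k g = 0 := congrArg Subtype.val h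
  rw [hK] at hg
  have hval : ∀ y, g y + (i * g u + j * g v + k * g w) * ind3 u v w y = 0 :=
    fun y => congrFun h' y
  have e2 : ∀ a b : ZMod 2, a + b * 1 = 0 → a = b := by decide
  have hu := e2 _ _ (ind3_u u v w ▸ hval u)
  have hv := e2 _ _ (ind3_v u v w ▸ hval v)
  have hw := e2 _ _ (ind3_w u v w ▸ hval w)
  have ho : ∀ y ∈ others u v w, g y = 0 := by
    intro y hy
    have := hval y
    rwa [ind3_o hy, mul_zero, add_zero] at this
  have hout : ∀ z, G.outer u v w z g = 0 := fun z =>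
    Finset.sum_eq_zero fun y hy => by rw [ho y hy, mul_zero]
  have hvu : g v = g u := hv.trans hu.symm
  have hwu : g w = g u := hw.trans hu.symm
  have hg2 := hg.2
  rw [hout, hout, hvu, hwu] at hg2
  rw [hvu, hwu] at hu
  have h0 := h2 _ hg2 hu.symm
  ext y
  show g y = 0
  by_cases hy : y ∈ others u v w
  · exact ho y hy
  · rw [mem_others] at hy
    by_cases hyu : y = u
    · rw [hyu, h0]
    by_cases hyv : y = v
    · rw [hyv, hvu, h0]
    by_cases hyw : y = w
    · rw [hyw, hwu, h0]
    tauto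

lemma finrank_succ (G : MarkedGraph V) (u v w : V)
    (hev : ∀ x ∈ others u v w, G.adj x u + G.adj x v + G.adj x w = 0)
    (T : Finset V) (K K' : Submodule (ZMod 2) (V → ZMod 2))
    (E E' : ZMod 2 → ZMod 2 → ZMod 2 → ZMod 2 → ZMod 2 → Prop)
    (hK : ∀ g, g ∈ K ↔ G.Rest u v w T g ∧
      E (g u) (g v) (g w) (G.outer u v w u g) (G.outer u v w v g))
    (hK' : ∀ g, g ∈ K' ↔ G.Rest u v w T g ∧
      E' (g u) (g v) (g w) (G.outer u v w u g) (G.outer u v w v g))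
    (h1 : ∀ a b c p q, E' a b c p q → E a b c p q)
    (h2 : E 1 1 1 0 0) (h3 : ¬ E' 1 1 1 0 0)
    (h4 : ∀ a b c p q, E a b c p q → E' (a + c) (b + c) (c + c) p q) :
    Module.finrank (ZMod 2) K = Module.finrank (ZMod 2) K' + 1 := by
  have hout : ∀ z, G.outer u v w z (ind3 u v w) = 0 := fun z =>
    Finset.sum_eq_zero fun y hy => by rw [ind3_o hy, mul_zero]
  have hne : ind3 u v w ≠ 0 := fun h => by
    have := congrFun h u
    rw [ind3_u] at this
    exact one_ne_zero this
  have hin : ind3 u v w ∈ K := by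
    rw [hK, hout, hout, ind3_u, ind3_v, ind3_w]
    exact ⟨rest_ind G u v w hev T, h2⟩
  have hnin : ind3 u v w ∉ K' := by
    rw [hK', hout, hout, ind3_u, ind3_v, ind3_w]
    exact fun h => h3 h.2
  have hsup : K = K' ⊔ Submodule.span (ZMod 2) {ind3 u v w} := by
    apply le_antisymm
    · intro g hg
      have hg' : g + g w • ind3 u v w ∈ K' := by
        rw [hK] at hg
        rw [hK']
        refine ⟨(rest_add G u v w hev T g _).2 hg.1, ?_⟩
        have := h4 _ _ _ _ _ hg.2
        simpa only [Pi.add_apply, Pi.smul_apply, smul_eq_mul, mul_one, outer_add,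
          ind3_u, ind3_v, ind3_w] using this
      have : g = (g + g w • ind3 u v w) + (- g w) • ind3 u v w := by
        rw [neg_smul]; abel
      rw [this]
      exact Submodule.add_mem_sup hg'
        (Submodule.smul_mem _ _ (Submodule.mem_span_singleton_self _))
    · refine sup_le (fun g hg => ?_) ?_
      · rw [hK'] at hg
        rw [hK]
        exact ⟨hg.1, h1 _ _ _ _ _ hg.2⟩
      · rw [Submodule.span_singleton_le_iff_mem]; exact hin
  have hinf : K' ⊓ Submodule.span (ZMod 2) {ind3 u v w} = ⊥ := by
    rw [← disjoint_iff, Submodule.disjoint_span_singleton' hne]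
    exact hnin
  have := Submodule.finrank_sup_add_finrank_inf_eq K' (Submodule.span (ZMod 2) {ind3 u v w})
  rw [hinf, finrank_bot, finrank_span_singleton hne, ← hsup, add_zero] at this
  exact this

lemma even_of_count (G : MarkedGraph V) {u v w : V}
    (huv : u ≠ v) (huw : u ≠ w) (hvw : v ≠ w) (x : V)
    (h : G.countAdj x {u, v, w} = 0 ∨ G.countAdj x {u, v, w} = 2) :
    G.adj x u + G.adj x v + G.adj x w = 0 := by
  unfold countAdj at h
  rw [Finset.filter_insert, Finset.filter_insert, Finset.filter_singleton] at h
  have h01 : ∀ a : ZMod 2, a = 0 ∨ a = 1 := by decide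
  rcases h01 (G.adj x u) with h1 | h1 <;> rcases h01 (G.adj x v) with h2 | h2 <;>
    rcases h01 (G.adj x w) with h3 | h3 <;> simp [h1, h2, h3, huv, huw, hvw] at h ⊢ <;>
    decide

/-- The three equations for `G` with diagonal entries `x, y, z`. -/
abbrev eqG (x y z a b c p q : ZMod 2) : Prop :=
  x * a + b + c + p = 0 ∧ a + y * b + c + q = 0 ∧ a + b + z * c + (p + q) = 0

/-- The three equations for the modified graph with diagonal entries `x, y, z`. -/
abbrev eqG' (x y z a b c p q : ZMod 2) : Prop :=
  x * a + p = 0 ∧ y * b + q = 0 ∧ z * c + (p + q) = 0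

lemma sum_powerset_split {M : Type*} [AddCommMonoid M] {u v w : V}
    (huv : u ≠ v) (huw : u ≠ w) (hvw : v ≠ w) (F : Finset V → M) :
    ∑ T, F T = ∑ T ∈ (others u v w).powerset,
      (((F T + F (insert w T)) + (F (insert v T) + F (insert v (insert w T))))
      + ((F (insert u T) + F (insert u (insert w T)))
        + (F (insert u (insert v T)) + F (insert u (insert v (insert w T)))))) := by
  have hw : w ∉ others u v w := by simp [mem_others]
  have hv : v ∉ insert w (others u v w) := by simp [mem_others, hvw]
  have hu : u ∉ insert v (insert w (others u v w)) := by simp [mem_others, huv, huw]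
  rw [← Finset.powerset_univ, univ_eq u v w, Finset.sum_powerset_insert hu,
    Finset.sum_powerset_insert hv, Finset.sum_powerset_insert hv,
    Finset.sum_powerset_insert hw, Finset.sum_powerset_insert hw,
    Finset.sum_powerset_insert hw, Finset.sum_powerset_insert hw]
  simp only [Finset.sum_add_distrib]

lemma reducedBracket_eq (G : MarkedGraph V) :
    G.reducedBracket = (-LaurentPolynomial.T 2 - LaurentPolynomial.T (-2)) ^ G.freeLoops *
      ∑ T : Finset V, LaurentPolynomial.T 1 ^ (Fintype.card V - T.card)
        * LaurentPolynomial.T (-1) ^ T.card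
        * (-LaurentPolynomial.T 2 - LaurentPolynomial.T (-2)) ^ nullity (G.subMat T) := by
  unfold reducedBracket bracket
  simp only [map_mul, map_pow, map_sum, aeval_X]
  rfl

lemma arith {R : Type*} [CommRing R] (A B d : R) (hAB : A * B = 1) (hd : d = - A ^ 2 - B ^ 2)
    (r m k k' e1 e2 e3 : ℕ) :
    A ^ (r + 3) * B ^ m * d ^ e1 + A ^ (r + 2) * B ^ (m + 1) * d ^ k
     + (A ^ (r + 2) * B ^ (m + 1) * d ^ k + A ^ (r + 1) * B ^ (m + 2) * d ^ (k + 1))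
     + (A ^ (r + 2) * B ^ (m + 1) * d ^ k' + A ^ (r + 1) * B ^ (m + 2) * d ^ e2
     + (A ^ (r + 1) * B ^ (m + 2) * d ^ e3 + A ^ r * B ^ (m + 3) * d ^ k))
    = A ^ (r + 3) * B ^ m * d ^ e1 + A ^ (r + 2) * B ^ (m + 1) * d ^ k'
     + (A ^ (r + 2) * B ^ (m + 1) * d ^ k' + A ^ (r + 1) * B ^ (m + 2) * d ^ (k' + 1))
     + (A ^ (r + 2) * B ^ (m + 1) * d ^ k + A ^ (r + 1) * B ^ (m + 2) * d ^ e2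
     + (A ^ (r + 1) * B ^ (m + 2) * d ^ e3 + A ^ r * B ^ (m + 3) * d ^ k')) := by
  have h : A ^ 2 * B + A * B ^ 2 * d + B ^ 3 = 0 := by
    subst hd
    linear_combination (- A ^ 2 * B - B ^ 3) * hAB
  linear_combination A ^ r * B ^ m * (d ^ k - d ^ k') * h

end MarkedGraph

open MarkedGraph

set_option maxHeartbeats 4000000

/-- If `u`, `v`, `w` are pairwise adjacent unmarked vertices, `u`
unlooped, `v` and `w` looped, and every vertex outside `{u,v,w}` is adjacent to 0 or
precisely 2 of `u,v,w`, then removing the three edges `{u,v}`, `{u,w}`, `{v,w}`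
leaves the reduced bracket unchanged. -/
theorem reducedBracket_omega3b {V : Type} [Fintype V] [DecidableEq V]
    (G : MarkedGraph V) (hsym : G.adj.IsSymm) (u v w : V)
    (huv : u ≠ v) (huw : u ≠ w) (hvw : v ≠ w)
    (hmu : G.marked u = false) (hmv : G.marked v = false) (hmw : G.marked w = false)
    (hauv : G.adj u v = 1) (hauw : G.adj u w = 1) (havw : G.adj v w = 1)
    (hu : G.adj u u = 0) (hv : G.adj v v = 1) (hw : G.adj w w = 1)
    (hout : ∀ x, x ≠ u → x ≠ v → x ≠ w →
      G.countAdj x {u, v, w} = 0 ∨ G.countAdj x {u, v, w} = 2) :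
    G.reducedBracket = (G.removeEdges3 u v w).reducedBracket := by
  classical
  have hev : ∀ x ∈ others u v w, G.adj x u + G.adj x v + G.adj x w = 0 := by
    intro x hx
    rw [mem_others] at hx
    exact even_of_count G huv huw hvw x (hout x hx.1 hx.2.1 hx.2.2)
  have havu : G.adj v u = 1 := by rw [← hsym.apply]; exact hauv
  have hawu : G.adj w u = 1 := by rw [← hsym.apply]; exact hauw
  have hawv : G.adj w v = 1 := by rw [← hsym.apply]; exact havw
  have houter : ∀ g, G.outer u v w w g = G.outer u v w u g + G.outer u v w v g := by
    intro g
    unfold outer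
    rw [← Finset.sum_add_distrib]
    refine Finset.sum_congr rfl fun y hy => ?_
    have h2 : ∀ a b c g : ZMod 2, a + b + c = 0 → c * g = a * g + b * g := by decide
    rw [hsym.apply y w, hsym.apply y u, hsym.apply y v]
    exact h2 _ _ _ _ (hev y hy)
  set H := G.removeEdges3 u v w with hH
  have hHadj : ∀ x y, (x ∈ others u v w ∨ y ∈ others u v w) → H.adj x y = G.adj x y := by
    intro x y h
    rw [mem_others, mem_others] at h
    simp only [hH, removeEdges3]
    rw [if_neg]
    rintro (⟨rfl, rfl⟩ | ⟨rfl, rfl⟩ | ⟨rfl, rfl⟩ | ⟨rfl, rfl⟩ | ⟨rfl, rfl⟩ | ⟨rfl, rfl⟩) <;> tauto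
  have hGK : ∀ (T T' : Finset V) (x y z : ZMod 2),
      (∀ y ∈ others u v w, (y ∈ T' ↔ y ∈ T)) →
      x = (if u ∈ T' then 1 else 0) → y = 1 + (if v ∈ T' then 1 else 0) →
      z = 1 + (if w ∈ T' then 1 else 0) → ∀ g, g ∈ G.bigKer T' ↔ G.Rest u v w T g ∧
      eqG x y z (g u) (g v) (g w) (G.outer u v w u g) (G.outer u v w v g) := by
    intro T T' x y z hT hx hy hz g
    rw [mem_bigKer_iff G G huv huw hvw hmu hmv hmw rfl (fun _ _ _ => rfl) T T' hT g,
      houter, hu, hv, hw, hauv, hauw, havw, havu, hawu, hawv, hx, hy, hz]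
    simp only [one_mul, zero_add]
  have hHK : ∀ (T T' : Finset V) (x y z : ZMod 2),
      (∀ y ∈ others u v w, (y ∈ T' ↔ y ∈ T)) →
      x = (if u ∈ T' then 1 else 0) → y = 1 + (if v ∈ T' then 1 else 0) →
      z = 1 + (if w ∈ T' then 1 else 0) → ∀ g, g ∈ H.bigKer T' ↔ G.Rest u v w T g ∧
      eqG' x y z (g u) (g v) (g w) (G.outer u v w u g) (G.outer u v w v g) := by
    intro T T' x y z hT hx hy hz g
    have e1 : H.adj u u = 0 := by simp [hH, removeEdges3, hu]
    have e2 : H.adj v v = 1 := by simp [hH, removeEdges3, hv, hvw, huv.symm]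
    have e3 : H.adj w w = 1 := by simp [hH, removeEdges3, hw, hvw.symm, huw.symm]
    have e4 : H.adj u v = 0 := by simp [hH, removeEdges3]
    have e5 : H.adj u w = 0 := by simp [hH, removeEdges3]
    have e6 : H.adj v w = 0 := by simp [hH, removeEdges3]
    have e7 : H.adj v u = 0 := by simp [hH, removeEdges3]
    have e8 : H.adj w u = 0 := by simp [hH, removeEdges3]
    have e9 : H.adj w v = 0 := by simp [hH, removeEdges3]
    rw [mem_bigKer_iff G H huv huw hvw hmu hmv hmw rfl hHadj T T' hT g,
      houter, e1, e2, e3, e4, e5, e6, e7, e8, e9, hx, hy, hz]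
    simp only [zero_mul, zero_add, add_zero]
  have hFL : H.freeLoops = G.freeLoops := rfl
  rw [reducedBracket_eq, reducedBracket_eq, hFL]
  congr 1
  rw [sum_powerset_split huv huw hvw, sum_powerset_split huv huw hvw]
  refine Finset.sum_congr rfl fun T hT => ?_
  rw [Finset.mem_powerset] at hT
  have huT : u ∉ T := fun h => (mem_others.1 (hT h)).1 rfl
  have hvT : v ∉ T := fun h => (mem_others.1 (hT h)).2.1 rfl
  have hwT : w ∉ T := fun h => (mem_others.1 (hT h)).2.2 rfl
  have c1 : (insert u T).card = T.card + 1 := by simp [huT]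
  have c2 : (insert v T).card = T.card + 1 := by simp [hvT]
  have c3 : (insert w T).card = T.card + 1 := by simp [hwT]
  have c4 : (insert v (insert w T)).card = T.card + 2 := by
    rw [Finset.card_insert_of_notMem (by simp [hvT, hvw]), c3]
  have c5 : (insert u (insert w T)).card = T.card + 2 := by
    rw [Finset.card_insert_of_notMem (by simp [huT, huw]), c3]
  have c6 : (insert u (insert v T)).card = T.card + 2 := by
    rw [Finset.card_insert_of_notMem (by simp [huT, huv]), c2]
  have c7 : (insert u (insert v (insert w T))).card = T.card + 3 := by
    rw [Finset.card_insert_of_notMem (by simp [huT, huv, huw]), c4]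
  obtain ⟨r, hr⟩ : ∃ r, Fintype.card V = T.card + 3 + r := by
    have := Finset.card_le_univ (insert u (insert v (insert w T)))
    rw [c7] at this
    exact Nat.exists_eq_add_of_le this
  have ho : ∀ y ∈ others u v w, y ≠ u ∧ y ≠ v ∧ y ≠ w := fun y => mem_others.1
  -- characterizations of all sixteen kernels
  have G0 := hGK T T 0 1 1 (by grind) (by grind) (by grind) (by grind)
  have Gw := hGK T (insert w T) 0 1 0 (by grind) (by grind) (by grind) (by simp; decide)
  have Gv := hGK T (insert v T) 0 0 1 (by grind) (by grind) (by simp; decide) (by grind)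
  have Gvw := hGK T (insert v (insert w T)) 0 0 0 (by grind) (by grind) (by simp; decide) (by simp; decide)
  have Gu := hGK T (insert u T) 1 1 1 (by grind) (by grind) (by grind) (by grind)
  have Guw := hGK T (insert u (insert w T)) 1 1 0 (by grind) (by grind) (by grind) (by simp; decide)
  have Guv := hGK T (insert u (insert v T)) 1 0 1 (by grind) (by grind) (by simp; decide) (by grind)
  have Guvw := hGK T (insert u (insert v (insert w T))) 1 0 0 (by grind) (by grind) (by simp; decide) (by simp; decide)
  have H0 := hHK T T 0 1 1 (by grind) (by grind) (by grind) (by grind)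
  have Hw := hHK T (insert w T) 0 1 0 (by grind) (by grind) (by grind) (by simp; decide)
  have Hv := hHK T (insert v T) 0 0 1 (by grind) (by grind) (by simp; decide) (by grind)
  have Hvw := hHK T (insert v (insert w T)) 0 0 0 (by grind) (by grind) (by simp; decide) (by simp; decide)
  have Hu := hHK T (insert u T) 1 1 1 (by grind) (by grind) (by grind) (by grind)
  have Huw := hHK T (insert u (insert w T)) 1 1 0 (by grind) (by grind) (by grind) (by simp; decide)
  have Huv := hHK T (insert u (insert v T)) 1 0 1 (by grind) (by grind) (by simp; decide) (by grind)
  have Huvw := hHK T (insert u (insert v (insert w T))) 1 0 0 (by grind) (by grind) (by simp; decide) (by simp; decide)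
  have S := fun K K' E E' hK hK' i j k h1 h2 =>
    finrank_le_of_shift G u v w hev T K K' E E' hK hK' i j k h1 h2
  -- equalities between the nullities
  have a1 := le_antisymm (S _ _ _ _ Gw Gv 0 0 1 (by decide) (by decide))
    (S _ _ _ _ Gv Gw 0 1 0 (by decide) (by decide))
  have a2 := le_antisymm (S _ _ _ _ Guvw Gv 0 0 1 (by decide) (by decide))
    (S _ _ _ _ Gv Guvw 1 0 0 (by decide) (by decide))
  have a3 := le_antisymm (S _ _ _ _ Hu Gv 0 0 1 (by decide) (by decide))
    (S _ _ _ _ Gv Hu 1 1 0 (by decide) (by decide))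
  have a4 := finrank_succ G u v w hev T _ _ _ _ Gvw Gv (by decide) (by decide) (by decide)
    (by decide)
  have b1 := le_antisymm (S _ _ _ _ Hw Hv 0 0 1 (by decide) (by decide))
    (S _ _ _ _ Hv Hw 0 1 0 (by decide) (by decide))
  have b2 := le_antisymm (S _ _ _ _ Huvw Hv 0 0 1 (by decide) (by decide))
    (S _ _ _ _ Hv Huvw 1 0 0 (by decide) (by decide))
  have b3 := le_antisymm (S _ _ _ _ Gu Hv 0 0 1 (by decide) (by decide))
    (S _ _ _ _ Hv Gu 1 1 0 (by decide) (by decide))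
  have b4 := finrank_succ G u v w hev T _ _ _ _ Hvw Hv (by decide) (by decide) (by decide)
    (by decide)
  have d1 := le_antisymm (S _ _ _ _ G0 H0 1 1 0 (by decide) (by decide))
    (S _ _ _ _ H0 G0 1 1 0 (by decide) (by decide))
  have d2 := le_antisymm (S _ _ _ _ Guw Huw 1 0 1 (by decide) (by decide))
    (S _ _ _ _ Huw Guw 1 0 1 (by decide) (by decide))
  have d3 := le_antisymm (S _ _ _ _ Guv Huv 1 1 0 (by decide) (by decide))
    (S _ _ _ _ Huv Guv 1 1 0 (by decide) (by decide))
  simp only [nullity_eq]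
  rw [c1, c2, c3, c4, c5, c6, c7, a1, a2, a3, a4, b1, b2, b3, b4, d1, d2, d3, hr]
  have s0 : T.card + 3 + r - T.card = r + 3 := by omega
  have s1 : T.card + 3 + r - (T.card + 1) = r + 2 := by omega
  have s2 : T.card + 3 + r - (T.card + 2) = r + 1 := by omega
  have s3 : T.card + 3 + r - (T.card + 3) = r := by omega
  rw [s0, s1, s2, s3]
  apply arith
  · rw [← LaurentPolynomial.T_add]; simp
  · rw [LaurentPolynomial.T_pow, LaurentPolynomial.T_pow]; norm_num
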